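/- Let Z be a weight operator satisfying Condition A(p) for some p ≥ 1, and set q = p − 1. Let A_0 be the smallest closed star-subalgebra of B(H) containing all compact operators and the set {S_α Z^l S_β* : l ≥ 0, 0 ≤ |α| = |β| ≤ q}, and let E = S_1^q (S_1^q)* (the projection associated with the word 11⋯1 of length q). Then E A_0 E is contained in the smallest closed star-subalgebra of B(H) containing all compact operators and the set {S_1^m Z^l S_1^{q−m} (S_1^q)* : 0 ≤ m ≤ q, l ≥ 0}. -/

import Mathlib

noncomputable section

instance (α : Type*) [DecidableEq α] : DecidableEq (FreeMonoid α) :=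
  fun a b => inferInstanceAs (Decidable (a.toList = b.toList))

/-- The full Fock space of `ℂ^d`, modeled as `ℓ²` of the free monoid on `Fin d`. -/
abbrev FockSpace (d : ℕ) : Type := lp (fun _ : FreeMonoid (Fin d) => ℂ) 2

/-- The standard basis vector `e_α` of the Fock space. -/
noncomputable def fockBasis (d : ℕ) (α : FreeMonoid (Fin d)) : FockSpace d :=
  lp.single 2 α (1 : ℂ)

/-- `S_α = S_{α₁} ⋯ S_{αₙ}` for a word `α` (with `S_∅ = 1`). -/
noncomputable def wordOp {d : ℕ} (S : Fin d → (FockSpace d →L[ℂ] FockSpace d))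
    (α : FreeMonoid (Fin d)) : FockSpace d →L[ℂ] FockSpace d :=
  (α.toList.map S).prod

section CuntzRelations

variable {R ι : Type*} [Ring R]

theorem annihilation_mul_creation_of_length_le [DecidableEq ι] {s t : ι → R}
    (hts : ∀ i j, t i * s j = if i = j then 1 else 0) (α γ : List ι)
    (h : α.length ≤ γ.length) :
    (γ.reverse.map t).prod * (α.map s).prod = 0 ∨
      ∃ γ', γ = α ++ γ' ∧
        (γ.reverse.map t).prod * (α.map s).prod = (γ'.reverse.map t).prod := by
  induction α generalizing γ with
  | nil => exact .inr ⟨γ, by simp⟩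
  | cons i α ih =>
    cases γ with
    | nil => simp at h
    | cons j γ =>
      have key : ((j :: γ).reverse.map t).prod * ((i :: α).map s).prod =
          (γ.reverse.map t).prod * (t j * s i) * (α.map s).prod := by
        simp [mul_assoc]
      rw [key, hts]
      split_ifs with hij
      · subst hij
        rcases ih γ (by simpa using h) with h0 | ⟨γ', rfl, h1⟩
        · exact .inl (by simpa using h0)
        · exact .inr ⟨γ', by simp, by simpa using h1⟩
      · exact .inl (by simp)

theorem annihilation_mul_creation_of_length_ge [DecidableEq ι] {s t : ι → R}
    (hts : ∀ i j, t i * s j = if i = j then 1 else 0) (β δ : List ι)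
    (h : β.length ≤ δ.length) :
    (β.reverse.map t).prod * (δ.map s).prod = 0 ∨
      ∃ δ', δ = β ++ δ' ∧
        (β.reverse.map t).prod * (δ.map s).prod = (δ'.map s).prod := by
  induction β generalizing δ with
  | nil => exact .inr ⟨δ, by simp⟩
  | cons i β ih =>
    cases δ with
    | nil => simp at h
    | cons j δ =>
      have key : ((i :: β).reverse.map t).prod * ((j :: δ).map s).prod =
          (β.reverse.map t).prod * (t i * s j) * (δ.map s).prod := by
        simp [mul_assoc]
      rw [key, hts]
      split_ifs with hij
      · subst hij
        rcases ih δ (by simpa using h) with h0 | ⟨δ', rfl, h1⟩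
        · exact .inl (by simpa using h0)
        · exact .inr ⟨δ', by simp, by simpa using h1⟩
      · exact .inl (by simp)

theorem annihilation_mul_creation_eq_zero_or_one [DecidableEq ι] {s t : ι → R}
    (hts : ∀ i j, t i * s j = if i = j then 1 else 0) (β δ : List ι)
    (h : β.length = δ.length) :
    (β.reverse.map t).prod * (δ.map s).prod = 0 ∨
      (β.reverse.map t).prod * (δ.map s).prod = 1 := by
  rcases annihilation_mul_creation_of_length_ge hts β δ h.le with h0 | ⟨δ', rfl, h1⟩
  · exact .inl h0
  · obtain rfl : δ' = [] := by simpa using h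
    exact .inr (by simpa using h1)

theorem exists_sum_creation_mul_annihilation_eq_one [Fintype ι] {s t : ι → R}
    (hst : ∑ i, s i * t i = 1) (n : ℕ) :
    ∃ F : Finset (List ι), (∀ ε ∈ F, ε.length = n) ∧
      ∑ ε ∈ F, (ε.map s).prod * (ε.reverse.map t).prod = 1 := by
  classical
  induction n with
  | zero => exact ⟨{[]}, by simp, by simp⟩
  | succ n ih =>
    obtain ⟨F, hF, hsum⟩ := ih
    refine ⟨(Finset.univ ×ˢ F).image fun x => x.1 :: x.2, ?_, ?_⟩
    · simp only [Finset.mem_image, Finset.mem_product]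
      rintro _ ⟨⟨i, ε⟩, ⟨-, hε⟩, rfl⟩
      simp [hF ε hε]
    · rw [Finset.sum_image (by rintro ⟨i, ε⟩ - ⟨j, ε'⟩ - h; simpa using h),
        Finset.sum_product, ← hst]
      refine Finset.sum_congr rfl fun i _ => ?_
      calc ∑ ε ∈ F, ((i :: ε).map s).prod * ((i :: ε).reverse.map t).prod
          = s i * (∑ ε ∈ F, (ε.map s).prod * (ε.reverse.map t).prod) * t i := by
            simp [Finset.mul_sum, Finset.sum_mul, mul_assoc]
        _ = s i * t i := by rw [hsum, mul_one]

/-- If `y` commutes with all products of `p` generators, then it intertwines all products of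
`j ≤ p` generators with one and the same element `w`. -/
theorem exists_intertwiner_of_commute_words [Fintype ι] {s t : ι → R}
    (hst : ∑ i, s i * t i = 1) {y : R} {p j : ℕ} (hj : j ≤ p)
    (hy : ∀ α : List ι, α.length = p → Commute (α.map s).prod y) :
    ∃ w, ∀ δ : List ι, δ.length = j → y * (δ.map s).prod = (δ.map s).prod * w := by
  obtain ⟨F, hF, hsum⟩ := exists_sum_creation_mul_annihilation_eq_one hst (p - j)
  refine ⟨∑ ε ∈ F, (ε.map s).prod * y * (ε.reverse.map t).prod, fun δ hδ => ?_⟩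
  rw [← mul_one (y * _), ← hsum, Finset.mul_sum, Finset.mul_sum]
  refine Finset.sum_congr rfl fun ε hε => ?_
  have h := (hy (δ ++ ε) (by rw [List.length_append, hδ, hF ε hε]; omega)).eq
  rw [List.map_append, List.prod_append] at h
  calc y * (δ.map s).prod * ((ε.map s).prod * (ε.reverse.map t).prod)
      = y * ((δ.map s).prod * (ε.map s).prod) * (ε.reverse.map t).prod := by
        simp only [mul_assoc]
    _ = _ := by rw [← h]; simp only [mul_assoc]

theorem compress_creation_annihilation [Fintype ι] [DecidableEq ι] {s t : ι → R}
    (hts : ∀ i j, t i * s j = if i = j then 1 else 0) (hst : ∑ i, s i * t i = 1)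
    {y : R} {p q : ℕ} (hqp : q ≤ p)
    (hy : ∀ α : List ι, α.length = p → Commute (α.map s).prod y)
    (o : ι) {α β γ δ : List ι} (hγ : γ.length = q) (hδ : δ.length = q)
    (hαβ : α.length = β.length) (hα : α.length ≤ q) :
    s o ^ q * (γ.reverse.map t).prod * ((α.map s).prod * y * (β.reverse.map t).prod) *
        (δ.map s).prod * t o ^ q = 0 ∨
      s o ^ q * (γ.reverse.map t).prod * ((α.map s).prod * y * (β.reverse.map t).prod) *
        (δ.map s).prod * t o ^ q = s o ^ α.length * y * s o ^ (q - α.length) * t o ^ q := by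
  have key : s o ^ q * (γ.reverse.map t).prod * ((α.map s).prod * y * (β.reverse.map t).prod) *
        (δ.map s).prod * t o ^ q =
      s o ^ q * ((γ.reverse.map t).prod * (α.map s).prod) * y *
        ((β.reverse.map t).prod * (δ.map s).prod) * t o ^ q := by
    simp only [mul_assoc]
  rw [key]
  rcases annihilation_mul_creation_of_length_le hts α γ (by omega) with h0 | ⟨γ', hγ', h1⟩
  · exact .inl (by rw [h0]; simp)
  rcases annihilation_mul_creation_of_length_ge hts β δ (by omega) with h0 | ⟨δ', hδ', h2⟩
  · exact .inl (by rw [h0]; simp)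
  have hγl : γ'.length = q - α.length := by
    have := congrArg List.length hγ'
    rw [List.length_append] at this
    omega
  have hδl : δ'.length = q - α.length := by
    have := congrArg List.length hδ'
    rw [List.length_append] at this
    omega
  obtain ⟨w, hw⟩ := exists_intertwiner_of_commute_words hst
    (j := q - α.length) (by omega) hy
  have hwo : y * s o ^ (q - α.length) = s o ^ (q - α.length) * w := by
    simpa using hw (List.replicate (q - α.length) o) (by simp)
  have h3 : s o ^ q * ((γ.reverse.map t).prod * (α.map s).prod) * y *
        ((β.reverse.map t).prod * (δ.map s).prod) * t o ^ q =
      s o ^ q * ((γ'.reverse.map t).prod * (δ'.map s).prod) * w * t o ^ q := by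
    rw [h1, h2, mul_assoc _ y, hw δ' hδl]
    simp only [mul_assoc]
  rw [h3]
  rcases annihilation_mul_creation_eq_zero_or_one hts γ' δ' (by omega) with h4 | h4
  · exact .inl (by rw [h4]; simp)
  · refine .inr ?_
    rw [h4, mul_one, mul_assoc _ y, hwo, ← mul_assoc, ← pow_add, Nat.add_sub_cancel' hα]

end CuntzRelations

theorem star_prod_map {R ι : Type*} [Ring R] [StarRing R] (S : ι → R) (α : List ι) :
    star (α.map S).prod = (α.reverse.map fun i => star (S i)).prod := by
  induction α with
  | nil => simp
  | cons i α ih =>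
    simp only [List.map_cons, List.prod_cons, List.reverse_cons, List.map_append,
      List.prod_append, List.map_nil, List.prod_nil, mul_one, star_mul, ih]

/-- If `S` satisfies the Cuntz relations modulo the kernel of `π`, and products of `p` of the `S i`
commute with `Z` modulo that kernel, then the compressions of the star-algebra generated by
`ker π` and the `S_α Z ^ l S_β*` lie in every star-subalgebra containing `ker π` and the elements
`S_o ^ m Z ^ l S_o ^ (q - m) (S_o ^ q)*`. -/
theorem compress_mem_of_mem_adjoin {A Q ι : Type*} [Ring A] [StarRing A] [Algebra ℂ A]
    [StarModule ℂ A] [Ring Q] [Fintype ι] [DecidableEq ι] (π : A →+* Q) {S : ι → A}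
    (hts : ∀ i j, π (star (S i)) * π (S j) = if i = j then 1 else 0)
    (hst : ∑ i, π (S i) * π (star (S i)) = 1) {Z : A} {p q : ℕ} (hqp : q ≤ p)
    (hZ : ∀ α : List ι, α.length = p → Commute (π (α.map S).prod) (π Z)) (o : ι)
    {B : StarSubalgebra ℂ A} (hker : ∀ x, π x = 0 → x ∈ B)
    (hgen : ∀ m l, m ≤ q → S o ^ m * Z ^ l * S o ^ (q - m) * star (S o ^ q) ∈ B)
    {a : A} (ha : a ∈ StarAlgebra.adjoin ℂ ({x | π x = 0} ∪
      {x | ∃ (α β : List ι) (l : ℕ), α.length = β.length ∧ α.length ≤ q ∧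
        x = (α.map S).prod * Z ^ l * star (β.map S).prod}))
    {γ δ : List ι} (hγ : γ.length = q) (hδ : δ.length = q) :
    S o ^ q * star (γ.map S).prod * a * (δ.map S).prod * star (S o ^ q) ∈ B := by
  set s := fun i => π (S i) with hs
  set t := fun i => π (star (S i)) with ht
  have hπS (α : List ι) : π (α.map S).prod = (α.map s).prod := by
    rw [map_list_prod, List.map_map]
    rfl
  have hπT (α : List ι) : π (star (α.map S).prod) = (α.reverse.map t).prod := by
    rw [star_prod_map, map_list_prod, List.map_map]
    rfl
  have hπo : π (star (S o ^ q)) = t o ^ q := by rw [star_pow, map_pow]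
  have hZs (l : ℕ) (α : List ι) (hα : α.length = p) :
      Commute (α.map s).prod (π Z ^ l) := by
    rw [← hπS]
    exact (hZ α hα).pow_right l
  have hmod {x y : A} (h : π x = π y) (hy : y ∈ B) : x ∈ B := by
    simpa using add_mem (hker (x - y) (by simp [h])) hy
  have hπφ (γ δ : List ι) (a : A) :
      π (S o ^ q * star (γ.map S).prod * a * (δ.map S).prod * star (S o ^ q)) =
        s o ^ q * (γ.reverse.map t).prod * π a * (δ.map s).prod * t o ^ q := by
    simp only [map_mul, hπS, hπT, hπo, map_pow, hs]
  induction ha using StarAlgebra.adjoin_induction generalizing γ δ with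
  | mem x hx =>
    rcases hx with hx | ⟨α, β, l, hαβ, hα, rfl⟩
    · exact hker _ (by rw [hπφ, Set.mem_ofPred_eq.mp hx]; simp)
    · have key := hπφ γ δ ((α.map S).prod * Z ^ l * star (β.map S).prod)
      rw [map_mul π (_ * _) (star (β.map S).prod), map_mul π _ (Z ^ l), hπS, hπT, map_pow] at key
      rcases compress_creation_annihilation (s := s) (t := t) hts hst hqp (hZs l) o hγ hδ hαβ hα
        with h | h
      · exact hker _ (key.trans h)
      · refine hmod (key.trans (h.trans ?_)) (hgen α.length l hα)
        simp only [map_mul, map_pow, hπo, hs]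
  | algebraMap r =>
    have hE : S o ^ q * star (S o ^ q) ∈ B := by simpa using hgen 0 0 q.zero_le
    rw [Algebra.algebraMap_eq_smul_one, mul_smul_comm, smul_mul_assoc, smul_mul_assoc]
    refine B.smul_mem ?_ r
    have hone := hπφ γ δ 1
    rw [map_one, mul_one (s o ^ q * _), mul_assoc (s o ^ q)] at hone
    rcases annihilation_mul_creation_eq_zero_or_one (s := s) (t := t) hts γ δ
      (hγ.trans hδ.symm) with h | h
    · exact hker _ (by rw [hone, h, mul_zero, zero_mul])
    · exact hmod (by rw [hone, h, mul_one, map_mul, map_pow, hπo]) hE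
  | add x y _ _ hx hy =>
    rw [mul_add, add_mul, add_mul]
    exact add_mem (hx hγ hδ) (hy hγ hδ)
  | mul x y _ _ hx hy =>
    obtain ⟨F, hF, hsum⟩ := exists_sum_creation_mul_annihilation_eq_one (s := s) (t := t) hst q
    refine hmod ?_ (sum_mem fun ε hε => mul_mem (hx hγ (hF ε hε)) (hy (hF ε hε) hδ))
    have hoo : t o ^ q * s o ^ q = 1 := pow_mul_pow_eq_one q (by simp [hs, ht, hts])
    have hterm (ε : List ι) :
        π ((S o ^ q * star (γ.map S).prod * x * (ε.map S).prod * star (S o ^ q)) *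
            (S o ^ q * star (ε.map S).prod * y * (δ.map S).prod * star (S o ^ q))) =
          s o ^ q * (γ.reverse.map t).prod * π x * ((ε.map s).prod * (ε.reverse.map t).prod) *
            (π y * (δ.map s).prod * t o ^ q) := by
      rw [map_mul, hπφ, hπφ]
      calc _ = s o ^ q * (γ.reverse.map t).prod * π x * (ε.map s).prod * (t o ^ q * s o ^ q) *
            ((ε.reverse.map t).prod * (π y * (δ.map s).prod * t o ^ q)) := by
              simp only [mul_assoc]
        _ = _ := by rw [hoo, mul_one]; simp only [mul_assoc]
    rw [map_sum, Finset.sum_congr rfl fun ε _ => hterm ε, ← Finset.sum_mul, ← Finset.mul_sum,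
      hsum, hπφ, map_mul]
    simp only [mul_assoc, one_mul]
  | star x _ hx =>
    simpa only [star_mul, star_star, mul_assoc] using star_mem (hx hδ hγ)

/-- The two-sided ideal of compact operators on a normed space. -/
def compactIdeal (E : Type*) [NormedAddCommGroup E] [NormedSpace ℂ E] :
    TwoSidedIdeal (E →L[ℂ] E) :=
  .mk' {Y | IsCompactOperator ⇑Y} isCompactOperator_zero (fun hx hy => hx.add hy)
    (fun hx => hx.neg) (fun {x _} hy => hy.clm_comp x) (fun {_ y} hx => hx.comp_clm y)

theorem mem_compactIdeal {E : Type*} [NormedAddCommGroup E] [NormedSpace ℂ E] {Y : E →L[ℂ] E} :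
    Y ∈ compactIdeal E ↔ IsCompactOperator ⇑Y :=
  TwoSidedIdeal.mem_mk' ..

theorem mk'_compactIdeal_eq_iff {E : Type*} [NormedAddCommGroup E] [NormedSpace ℂ E]
    {X Y : E →L[ℂ] E} :
    (compactIdeal E).ringCon.mk' X = (compactIdeal E).ringCon.mk' Y ↔
      IsCompactOperator ⇑(X - Y) := by
  rw [← mem_compactIdeal, ← TwoSidedIdeal.rel_iff]
  exact RingCon.eq _

section Fock

open ContinuousLinearMap

variable {d : ℕ} {S : Fin d → (FockSpace d →L[ℂ] FockSpace d)}

theorem inner_fockBasis_left (α : FreeMonoid (Fin d)) (f : FockSpace d) :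
    inner ℂ (fockBasis d α) f = f α := by
  simp [fockBasis, lp.inner_single_left]

theorem hasSum_smul_fockBasis (f : FockSpace d) : HasSum (fun α => f α • fockBasis d α) f := by
  convert lp.hasSum_single ENNReal.ofNat_ne_top f using 2 with α
  rw [fockBasis, ← lp.single_smul, smul_eq_mul, mul_one]

theorem ext_fockBasis {A B : FockSpace d →L[ℂ] FockSpace d}
    (h : ∀ α, A (fockBasis d α) = B (fockBasis d α)) : A = B := by
  ext1 f
  refine (A.hasSum (hasSum_smul_fockBasis f)).unique ?_
  simpa [h] using B.hasSum (hasSum_smul_fockBasis f)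

theorem adjoint_shift_mul_shift
    (hS : ∀ (i : Fin d) (α : FreeMonoid (Fin d)),
      S i (fockBasis d α) = fockBasis d (FreeMonoid.of i * α)) (i j : Fin d) :
    adjoint (S i) * S j = if i = j then 1 else 0 := by
  refine ext_fockBasis fun β => ?_
  ext α
  rw [← inner_fockBasis_left, mul_apply_eq_comp, adjoint_inner_right, hS, hS, inner_fockBasis_left,
    fockBasis, lp.single_apply, Pi.single_apply]
  have hinj : FreeMonoid.of i * α = FreeMonoid.of j * β ↔ i = j ∧ α = β := List.cons_eq_cons
  simp only [hinj]
  by_cases hij : i = j <;>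
    simp [hij, fockBasis, lp.single_apply, Pi.single_apply]

theorem isCompactOperator_one_sub_sum_shift
    (hS : ∀ (i : Fin d) (α : FreeMonoid (Fin d)),
      S i (fockBasis d α) = fockBasis d (FreeMonoid.of i * α)) :
    IsCompactOperator ⇑(1 - ∑ i, S i * adjoint (S i)) := by
  set T := 1 - ∑ i, S i * adjoint (S i) with hT
  have hTS (j : Fin d) : T * S j = 0 := by
    simp [hT, sub_mul, Finset.sum_mul, mul_assoc, adjoint_shift_mul_shift hS]
  have hTe : T = (toSpanSingleton ℂ (T (fockBasis d 1))).comp (innerSL ℂ (fockBasis d 1)) := by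
    refine ext_fockBasis fun α => ?_
    rw [comp_apply, innerSL_apply_apply, inner_fockBasis_left, toSpanSingleton_apply]
    induction α using FreeMonoid.casesOn with
    | one => simp [fockBasis]
    | of_mul j α =>
      have hne : (1 : FreeMonoid (Fin d)) ≠ FreeMonoid.of j * α :=
        (List.cons_ne_nil j α.toList).symm
      rw [← hS, ← mul_apply_eq_comp, hTS, hS]
      simp [fockBasis, lp.single_apply, hne]
  rw [hTe]
  exact (isCompactOperator_of_locallyCompactSpace_dom
    (innerSL ℂ (fockBasis d 1))).clm_comp (toSpanSingleton ℂ (T (fockBasis d 1)))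

end Fock

open ContinuousLinearMap in
theorem statement12 (d : ℕ) (hd : 0 < d)
    (S : Fin d → (FockSpace d →L[ℂ] FockSpace d))
    (hS : ∀ (i : Fin d) (α : FreeMonoid (Fin d)),
      S i (fockBasis d α) = fockBasis d (FreeMonoid.of i * α))
    (P : ℕ → (FockSpace d →L[ℂ] FockSpace d))
    (hP : ∀ (k : ℕ) (α : FreeMonoid (Fin d)),
      P k (fockBasis d α) = if α.length = k then fockBasis d α else 0)
    (Z : FockSpace d →L[ℂ] FockSpace d)
    (hZinv : IsUnit Z)
    (hZP : ∀ k : ℕ, Z * P k = P k * Z)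
    (hZ0 : Z * P 0 = P 0)
    (p : ℕ) (hp : 1 ≤ p)
    (hAp : ∀ α : FreeMonoid (Fin d), α.length = p →
      IsCompactOperator ⇑(wordOp S α * Z - Z * wordOp S α))
    (q : ℕ) (hq : q = p - 1)
    (S1 : FockSpace d →L[ℂ] FockSpace d) (hS1 : S1 = S ⟨0, hd⟩)
    (A0 : StarSubalgebra ℂ (FockSpace d →L[ℂ] FockSpace d))
    (hA0 : A0 = (StarAlgebra.adjoin ℂ
      ({Y : FockSpace d →L[ℂ] FockSpace d | IsCompactOperator ⇑Y} ∪
        {x | ∃ (α β : FreeMonoid (Fin d)) (l : ℕ),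
          α.length = β.length ∧ α.length ≤ q ∧
          x = wordOp S α * Z ^ l * adjoint (wordOp S β)})).topologicalClosure) :
    ∀ a ∈ A0,
      (S1 ^ q * adjoint (S1 ^ q)) * a * (S1 ^ q * adjoint (S1 ^ q)) ∈
        (StarAlgebra.adjoin ℂ
          ({Y : FockSpace d →L[ℂ] FockSpace d | IsCompactOperator ⇑Y} ∪
            {x | ∃ (m l : ℕ), m ≤ q ∧
              x = S1 ^ m * Z ^ l * S1 ^ (q - m) * adjoint (S1 ^ q)})).topologicalClosure := by
  subst hA0 hS1
  set o : Fin d := ⟨0, hd⟩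
  set B := (StarAlgebra.adjoin ℂ
    ({Y : FockSpace d →L[ℂ] FockSpace d | IsCompactOperator ⇑Y} ∪
      {x | ∃ (m l : ℕ), m ≤ q ∧ x = S o ^ m * Z ^ l * S o ^ (q - m) *
        adjoint (S o ^ q)})).topologicalClosure
  have hclosed : IsClosed (B : Set (FockSpace d →L[ℂ] FockSpace d)) :=
    StarSubalgebra.isClosed_topologicalClosure _
  set π := (compactIdeal (FockSpace d)).ringCon.mk'
  have hπ (Y : FockSpace d →L[ℂ] FockSpace d) : π Y = 0 ↔ IsCompactOperator ⇑Y := by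
    rw [← map_zero π, mk'_compactIdeal_eq_iff, sub_zero]
  have hts (i j : Fin d) : π (star (S i)) * π (S j) = if i = j then 1 else 0 := by
    rw [star_eq_adjoint, ← map_mul, adjoint_shift_mul_shift hS]
    split_ifs
    · exact map_one π
    · exact map_zero π
  have hst : ∑ i, π (S i) * π (star (S i)) = 1 := by
    simp only [← map_mul, ← map_sum]
    rw [← map_one π]
    exact (mk'_compactIdeal_eq_iff.2 (isCompactOperator_one_sub_sum_shift hS)).symm
  have hZπ (α : List (Fin d)) (hα : α.length = p) :
      Commute (π (α.map S).prod) (π Z) := by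
    rw [Commute, SemiconjBy, ← map_mul, ← map_mul]
    exact mk'_compactIdeal_eq_iff.2 (hAp (FreeMonoid.ofList α) hα)
  have hker (Y : FockSpace d →L[ℂ] FockSpace d) (hY : π Y = 0) : Y ∈ B :=
    StarSubalgebra.le_topologicalClosure _
      (StarAlgebra.subset_adjoin ℂ _ (.inl ((hπ Y).1 hY)))
  have hgen (m l : ℕ) (hm : m ≤ q) :
      S o ^ m * Z ^ l * S o ^ (q - m) * star (S o ^ q) ∈ B :=
    StarSubalgebra.le_topologicalClosure _
      (StarAlgebra.subset_adjoin ℂ _ (.inr ⟨m, l, hm, rfl⟩))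
  intro a ha
  have hcont : Continuous fun a : FockSpace d →L[ℂ] FockSpace d =>
      (S o ^ q * adjoint (S o ^ q)) * a * (S o ^ q * adjoint (S o ^ q)) := by fun_prop
  rw [← SetLike.mem_coe, ← hclosed.closure_eq]
  refine map_mem_closure
    (f := fun a => (S o ^ q * adjoint (S o ^ q)) * a * (S o ^ q * adjoint (S o ^ q))) hcont ha fun a ha => ?_
  have ha' : a ∈ StarAlgebra.adjoin ℂ ({x | π x = 0} ∪
      {x | ∃ (α β : List (Fin d)) (l : ℕ), α.length = β.length ∧ α.length ≤ q ∧
        x = (α.map S).prod * Z ^ l * star (β.map S).prod}) := by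
    simp only [hπ]
    exact ha
  have h := compress_mem_of_mem_adjoin π hts hst (by omega) hZπ o hker hgen ha'
    (List.length_replicate (n := q) (a := o)) (List.length_replicate (n := q) (a := o))
  simpa only [SetLike.mem_coe, List.map_replicate, List.prod_replicate, star_eq_adjoint, mul_assoc] using h
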